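/- The normal coordinate ψ^{T₃} of the three-vertex ladder tree has in the toy model only a simple pole with c-independent residue π²/18: for every real c > 0, the limit as ε → 0⁺ of (I₃(c,ε) - I₁(c,ε)·I₂(c,ε) + ⅓·I₁(c,ε)³ - π²/(18ε)) equals -(π²/6)·log c. -/

import Mathlib

open MeasureTheory Real Filter

noncomputable section

/-- The toy-model integral `I₁(c,ε) = ∫₀^∞ y^{-ε}/(y+c) dy`. -/
def I1 (c ε : ℝ) : ℝ := ∫ y in Set.Ioi (0 : ℝ), y ^ (-ε) / (y + c)

/-- The nested toy-model integral of the two-vertex ladder tree,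
`I₂(c,ε) = ∫₀^∞ (y^{-ε}/(y+c)) I₁(y,ε) dy`. -/
def I2 (c ε : ℝ) : ℝ := ∫ y in Set.Ioi (0 : ℝ), (y ^ (-ε) / (y + c)) * I1 y ε
/-- The nested toy-model integral of the three-vertex ladder tree,
`I₃(c,ε) = ∫₀^∞ (y^{-ε}/(y+c)) I₂(y,ε) dy`. -/
def I3 (c ε : ℝ) : ℝ := ∫ y in Set.Ioi (0 : ℝ), (y ^ (-ε) / (y + c)) * I2 y ε

/-- The Beta-type integral `∫₀^∞ y^{-ε}/(y+c) dy = c^{-ε} π / sin (π ε)`. -/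
lemma I1_eq {c ε : ℝ} (hc : 0 < c) (h0 : 0 < ε) (h1 : ε < 1) :
    I1 c ε = c ^ (-ε) * (π / sin (π * ε)) := by
  have hΓ₀ : 0 < Gamma ε := Gamma_pos_of_pos h0
  have hΓ₁ : 0 < Gamma (1 - ε) := Gamma_pos_of_pos (by linarith)
  have inner_t : ∀ y ∈ Set.Ioi (0 : ℝ),
      ENNReal.ofReal (y ^ (-ε) / (y + c)) =
        ∫⁻ t in Set.Ioi (0 : ℝ), ENNReal.ofReal (y ^ (-ε) * exp (-((y + c) * t))) := by
    intro y (hy : 0 < y)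
    have hyc : 0 < y + c := by positivity
    have hval : ∫ t in Set.Ioi (0 : ℝ), y ^ (-ε) * exp (-((y + c) * t)) =
        y ^ (-ε) / (y + c) := by
      have := integral_rpow_mul_exp_neg_mul_Ioi one_pos hyc
      simp only [sub_self, rpow_zero, one_mul, rpow_one, Gamma_one, mul_one] at this
      rw [integral_const_mul, this, mul_one_div]
    rw [← hval, ofReal_integral_eq_lintegral_ofReal]
    · exact .of_integral_ne_zero (by rw [hval]; positivity)
    · exact .of_forall fun t => by positivity
  have inner_y : ∀ t ∈ Set.Ioi (0 : ℝ),
      ∫⁻ y in Set.Ioi (0 : ℝ), ENNReal.ofReal (y ^ (-ε) * exp (-((y + c) * t))) =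
        ENNReal.ofReal (Gamma (1 - ε) * (t ^ (ε - 1) * exp (-(c * t)))) := by
    intro t (ht : 0 < t)
    have hval : ∫ y in Set.Ioi (0 : ℝ), y ^ (-ε) * exp (-((y + c) * t)) =
        Gamma (1 - ε) * (t ^ (ε - 1) * exp (-(c * t))) := by
      have := integral_rpow_mul_exp_neg_mul_Ioi (a := 1 - ε) (by linarith) ht
      rw [show 1 - ε - 1 = -ε by ring, one_div, inv_rpow ht.le, ← rpow_neg ht.le, neg_sub]
        at this
      calc _ = ∫ y in Set.Ioi (0 : ℝ), (y ^ (-ε) * exp (-(t * y))) * exp (-(c * t)) := by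
            congr 1 with y
            rw [mul_assoc, ← exp_add]
            ring_nf
        _ = _ := by rw [integral_mul_const, this]; ring
    rw [← hval, ofReal_integral_eq_lintegral_ofReal]
    · exact .of_integral_ne_zero (by rw [hval]; positivity)
    · filter_upwards [ae_restrict_mem measurableSet_Ioi] with y (hy : 0 < y)
      positivity
  have outer : ∫ t in Set.Ioi (0 : ℝ), Gamma (1 - ε) * (t ^ (ε - 1) * exp (-(c * t))) =
      c ^ (-ε) * (π / sin (π * ε)) := by
    rw [integral_const_mul, integral_rpow_mul_exp_neg_mul_Ioi h0 hc,
      ← Gamma_mul_Gamma_one_sub, one_div, inv_rpow hc.le, ← rpow_neg hc.le]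
    ring
  have hpos : 0 < c ^ (-ε) * (π / sin (π * ε)) := by
    rw [← Gamma_mul_Gamma_one_sub]
    positivity
  have key : ∫⁻ y in Set.Ioi (0 : ℝ), ENNReal.ofReal (y ^ (-ε) / (y + c)) =
      ENNReal.ofReal (c ^ (-ε) * (π / sin (π * ε))) := by
    rw [setLIntegral_congr_fun measurableSet_Ioi inner_t, lintegral_lintegral_swap (by fun_prop),
      setLIntegral_congr_fun measurableSet_Ioi inner_y, ← outer,
      ofReal_integral_eq_lintegral_ofReal]
    · exact .of_integral_ne_zero (by rw [outer]; exact hpos.ne')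
    · filter_upwards [ae_restrict_mem measurableSet_Ioi] with t (ht : 0 < t)
      positivity
  rw [I1, integral_eq_lintegral_of_nonneg_ae, key, ENNReal.toReal_ofReal hpos.le]
  · filter_upwards [ae_restrict_mem measurableSet_Ioi] with y (hy : 0 < y)
    simp only [Pi.zero_apply]
    positivity
  · exact Measurable.aestronglyMeasurable (by fun_prop)

lemma integral_mul_const_mul_rpow {c ε a b : ℝ} {f : ℝ → ℝ}
    (hf : ∀ y, 0 < y → f y = y ^ (-a) * b) :
    ∫ y in Set.Ioi (0 : ℝ), y ^ (-ε) / (y + c) * f y = I1 c (ε + a) * b := by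
  rw [I1, ← integral_mul_const]
  refine setIntegral_congr_fun measurableSet_Ioi fun y (hy : 0 < y) => ?_
  simp only [hf y hy, neg_add, rpow_add hy]
  ring

lemma I2_eq {c ε : ℝ} (hc : 0 < c) (h0 : 0 < ε) (h1 : ε < 1 / 2) :
    I2 c ε = c ^ (-(2 * ε)) * (π / sin (π * (2 * ε)) * (π / sin (π * ε))) := by
  rw [I2, integral_mul_const_mul_rpow fun y hy => I1_eq hy h0 (by linarith), ← two_mul,
    I1_eq hc (by linarith) (by linarith), mul_assoc]

lemma I3_eq {c ε : ℝ} (hc : 0 < c) (h0 : 0 < ε) (h1 : ε < 1 / 3) :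
    I3 c ε = c ^ (-(3 * ε)) *
      (π / sin (π * (3 * ε)) * (π / sin (π * (2 * ε)) * (π / sin (π * ε)))) := by
  rw [I3, integral_mul_const_mul_rpow fun y hy => I2_eq hy h0 (by linarith),
    show ε + 2 * ε = 3 * ε by ring, I1_eq hc (by linarith) (by linarith), mul_assoc]

/-- The normal coordinate is `π³ / sin x` times a function of `cos x` regular at `x = 0`,
written in terms of `x = π ε`. -/
lemma cosecant_combination {x : ℝ} (h0 : 0 < x) (h1 : x < π / 3) :
    π / sin (3 * x) * (π / sin (2 * x) * (π / sin x))
      - π / sin x * (π / sin (2 * x) * (π / sin x)) + 1 / 3 * (π / sin x) ^ 3 =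
    π ^ 3 * ((6 + 4 * cos x - 8 * cos x ^ 2) /
      ((1 + cos x) * (6 * cos x * (4 * cos x ^ 2 - 1)))) / sin x := by
  have hs : 0 < sin x := sin_pos_of_pos_of_lt_pi h0 (by linarith [pi_pos])
  have hc : 1 / 2 < cos x := by
    rw [← cos_pi_div_three]
    exact cos_lt_cos_of_nonneg_of_le_pi h0.le (by linarith [pi_pos]) h1
  have h4 : 0 < 4 * cos x ^ 2 - 1 := by nlinarith
  have hsq : sin x ^ 2 = 1 - cos x ^ 2 := sin_sq x
  have h3 : sin (3 * x) = sin x * (4 * cos x ^ 2 - 1) := by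
    rw [sin_three_mul]
    linear_combination (-4 * sin x) * hsq
  have hc0 : 0 < cos x := by linarith
  rw [h3, sin_two_mul]
  have : 0 < 1 + cos x := by linarith
  field_simp
  rw [hsq]
  ring

lemma tendsto_inv_sin_sub_inv :
    Tendsto (fun x : ℝ => 1 / sin x - 1 / x) (nhdsWithin 0 (Set.Ioi 0)) (nhds 0) := by
  have hid : Tendsto (fun x : ℝ => x) (nhdsWithin 0 (Set.Ioi 0)) (nhds 0) :=
    tendsto_id.mono_left nhdsWithin_le_nhds
  have hsinc : Tendsto sinc (nhdsWithin 0 (Set.Ioi 0)) (nhds 1) := by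
    simpa using (continuous_sinc.tendsto 0).mono_left nhdsWithin_le_nhds
  have hquot : Tendsto (fun x : ℝ => (x - sin x) / x ^ 2) (nhdsWithin 0 (Set.Ioi 0)) (nhds 0) := by
    refine squeeze_zero' (g := fun x => x / 6) ?_ ?_ (by simpa using hid.div_const 6)
    · filter_upwards [self_mem_nhdsWithin] with x (hx : 0 < x)
      exact div_nonneg (by linarith [sin_lt hx]) (by positivity)
    · filter_upwards [self_mem_nhdsWithin] with x (hx : 0 < x)
      rw [div_le_iff₀ (by positivity)]
      nlinarith [sin_gt_sub_cube hx]
  have := hquot.div hsinc one_ne_zero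
  rw [zero_div] at this
  refine this.congr' ?_
  filter_upwards [Ioo_mem_nhdsGT pi_pos] with x hx
  have h0 : x ≠ 0 := hx.1.ne'
  have hs : sin x ≠ 0 := (sin_pos_of_pos_of_lt_pi hx.1 hx.2).ne'
  simp only [Pi.div_apply, sinc_of_ne_zero h0]
  field_simp

/-- The regular part `c^{-3ε} h(cos (π ε))` of the normal coordinate. -/
def regularPart (c ε : ℝ) : ℝ :=
  c ^ (-(3 * ε)) * ((6 + 4 * cos (π * ε) - 8 * cos (π * ε) ^ 2) /
    ((1 + cos (π * ε)) * (6 * cos (π * ε) * (4 * cos (π * ε) ^ 2 - 1))))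

lemma regularPart_zero (c : ℝ) : regularPart c 0 = 1 / 18 := by
  norm_num [regularPart]

lemma hasDerivAt_regularPart {c : ℝ} (hc : 0 < c) :
    HasDerivAt (regularPart c) (-(log c / 6)) 0 := by
  have hcos : HasDerivAt (fun ε : ℝ => cos (π * ε)) 0 0 := by
    simpa using ((hasDerivAt_id (0 : ℝ)).const_mul π).cos
  have hpow : HasDerivAt (fun ε : ℝ => c ^ (-(3 * ε))) (-(3 * log c)) 0 := by
    simpa [mul_comm] using (((hasDerivAt_id (0 : ℝ)).const_mul 3).neg).const_rpow hc
  have hnum := ((hcos.const_mul 4).const_add 6).sub ((hcos.pow 2).const_mul 8)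
  have hden := (hcos.const_add 1).mul
    ((hcos.const_mul 6).mul (((hcos.pow 2).const_mul 4).sub_const 1))
  have := hpow.mul (hnum.div hden (by norm_num))
  convert! this using 1
  norm_num
  ring

/-- The normal coordinate `ψ^{T₃} = φ^{T₃} - φ^{T₁}φ^{T₂} + ⅓(φ^{T₁})³` of the
three-vertex ladder tree has only a simple pole with `c`-independent residue
`π²/18`:  `I₃ - I₁·I₂ + ⅓I₁³ - π²/(18ε) → -(π²/6)·log c` as `ε → 0⁺`. -/
theorem toy_model_psi3_ladder (c : ℝ) (hc : 0 < c) :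
    Tendsto (fun ε : ℝ =>
        I3 c ε - I1 c ε * I2 c ε + (1 / 3) * (I1 c ε) ^ 3 - π ^ 2 / (18 * ε))
      (nhdsWithin 0 (Set.Ioi 0)) (nhds (-(π ^ 2 / 6) * Real.log c)) := by
  have hmem : Set.Ioo (0 : ℝ) (1 / 3) ∈ nhdsWithin 0 (Set.Ioi 0) := Ioo_mem_nhdsGT (by norm_num)
  have hπε : Tendsto (fun ε : ℝ => π * ε) (nhdsWithin 0 (Set.Ioi 0))
      (nhdsWithin 0 (Set.Ioi 0)) := by
    refine tendsto_nhdsWithin_iff.2 ⟨?_, ?_⟩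
    · exact (Continuous.tendsto' (by fun_prop) _ _ (by simp)).mono_left nhdsWithin_le_nhds
    · filter_upwards [self_mem_nhdsWithin] with ε (hε : 0 < ε)
      exact mul_pos pi_pos hε
  have hsinc : Tendsto (fun ε : ℝ => sinc (π * ε)) (nhdsWithin 0 (Set.Ioi 0)) (nhds 1) := by
    rw [← sinc_zero]
    exact (continuous_sinc.tendsto 0).comp (hπε.mono_right nhdsWithin_le_nhds)
  have hslope := (hasDerivAt_regularPart hc).tendsto_slope_zero_right
  have hlim := ((hslope.div hsinc one_ne_zero).const_mul (π ^ 2)).add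
    ((tendsto_inv_sin_sub_inv.comp hπε).const_mul (π ^ 3 / 18))
  rw [show π ^ 2 * (-(log c / 6) / 1) + π ^ 3 / 18 * 0 = -(π ^ 2 / 6) * log c by ring] at hlim
  refine hlim.congr' ?_
  filter_upwards [hmem] with ε ⟨h0, h1⟩
  have hx0 : 0 < π * ε := mul_pos pi_pos h0
  have hx1 : π * ε < π / 3 := by nlinarith [pi_pos]
  have hs : sin (π * ε) ≠ 0 := (sin_pos_of_pos_of_lt_pi hx0 (by linarith [pi_pos])).ne'
  have hpow2 : c ^ (-(2 * ε)) = c ^ (-ε) * c ^ (-ε) := by rw [← rpow_add hc]; ring_nf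
  have hpow3 : c ^ (-(3 * ε)) = c ^ (-ε) * c ^ (-ε) * c ^ (-ε) := by
    rw [← rpow_add hc, ← rpow_add hc]; ring_nf
  have hcomb : I3 c ε - I1 c ε * I2 c ε + (1 / 3) * (I1 c ε) ^ 3 =
      π ^ 3 * regularPart c ε / sin (π * ε) := by
    have h := cosecant_combination hx0 hx1
    rw [I1_eq hc h0 (by linarith), I2_eq hc h0 (by linarith), I3_eq hc h0 h1, regularPart,
      mul_left_comm π 2 ε, mul_left_comm π 3 ε, hpow2, hpow3]
    linear_combination (c ^ (-ε) * c ^ (-ε) * c ^ (-ε)) * h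
  rw [hcomb]
  simp only [Pi.div_apply, Function.comp_apply, zero_add, regularPart_zero, smul_eq_mul,
    sinc_of_ne_zero hx0.ne']
  field_simp
  ring

end
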